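/- There is no graph Γ ∈ 𝒢₃(θ0,θ1,θ2) with exactly three distinct vertex degrees whose vertex set admits a partition into sets V1, V2, V3, each of size at least 2, such that each induced subgraph Γ[V1], Γ[V2], Γ[V3] is a regular graph, and for each pair of distinct indices i, j the bipartite graph between V_i and V_j is either complete (every vertex of V_i adjacent to every vertex of V_j) or empty (no edges between V_i and V_j). -/

import Mathlib

/-- `θ` is an eigenvalue of the (real) adjacency matrix of `G`. -/
def adjEig {V : Type} [Fintype V] [DecidableEq V] (G : SimpleGraph V) [DecidableRel G.Adj]
    (θ : ℝ) : Prop :=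
  ∃ f : V → ℝ, f ≠ 0 ∧ (SimpleGraph.adjMatrix ℝ G).mulVec f = θ • f

/-- `Γ ∈ 𝒢₃(θ0,θ1,θ2)`: `Γ` is connected and the set of eigenvalues of its adjacency
matrix is exactly `{θ0, θ1, θ2}`, where `θ0 > θ1 > θ2`. -/
def InG3 {V : Type} [Fintype V] [DecidableEq V] (G : SimpleGraph V) [DecidableRel G.Adj]
    (θ0 θ1 θ2 : ℝ) : Prop :=
  G.Connected ∧ θ1 < θ0 ∧ θ2 < θ1 ∧ {θ : ℝ | adjEig G θ} = {θ0, θ1, θ2}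

open Matrix in
theorem Matrix.IsHermitian.cubic_eq_zero {n : Type*} [Fintype n] [DecidableEq n]
    {A : Matrix n n ℝ} (hA : A.IsHermitian) {a b c : ℝ}
    (h : ∀ f : n → ℝ, ∀ θ : ℝ, f ≠ 0 → A *ᵥ f = θ • f → θ = a ∨ θ = b ∨ θ = c) :
    (A - a • (1 : Matrix n n ℝ)) * ((A - b • (1 : Matrix n n ℝ)) * (A - c • (1 : Matrix n n ℝ))) =
      0 := by
  apply (Matrix.toEuclideanLin (𝕜 := ℝ)).injective
  refine hA.eigenvectorBasis.toBasis.ext fun i => ?_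
  have he := hA.mulVec_eigenvectorBasis i
  have hne : (⇑(hA.eigenvectorBasis i) : n → ℝ) ≠ 0 := by
    intro h0
    exact hA.eigenvectorBasis.orthonormal.ne_zero i (by ext j; exact congrFun h0 j)
  have hθ := h _ _ hne he
  generalize hA.eigenvalues i = θ at *
  rw [OrthonormalBasis.coe_toBasis, map_zero, LinearMap.zero_apply, Matrix.toLpLin_apply]
  have key : ∀ t : ℝ, (A - t • (1 : Matrix n n ℝ)) *ᵥ ⇑(hA.eigenvectorBasis i) =
      (θ - t) • ⇑(hA.eigenvectorBasis i) := by
    intro t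
    rw [Matrix.sub_mulVec, he, Matrix.smul_mulVec, Matrix.one_mulVec, sub_smul]
  have : ((A - a • (1 : Matrix n n ℝ)) * ((A - b • (1 : Matrix n n ℝ)) *
      (A - c • (1 : Matrix n n ℝ)))) *ᵥ ⇑(hA.eigenvectorBasis i) = 0 := by
    rw [← Matrix.mulVec_mulVec, ← Matrix.mulVec_mulVec, key, Matrix.mulVec_smul, key,
      Matrix.mulVec_smul, Matrix.mulVec_smul, key, smul_smul, smul_smul]
    rcases hθ with rfl | rfl | rfl <;> simp
  rw [this]
  rfl

open Matrix in
theorem Matrix.IsHermitian.posSemidef_of_eigenvector {n : Type*} [Fintype n] [DecidableEq n]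
    {A : Matrix n n ℝ} (hA : A.IsHermitian)
    (h : ∀ f : n → ℝ, ∀ θ : ℝ, f ≠ 0 → A *ᵥ f = θ • f → 0 ≤ θ) : A.PosSemidef := by
  rw [hA.posSemidef_iff_eigenvalues_nonneg]
  intro i
  refine h _ _ ?_ (hA.mulVec_eigenvectorBasis i)
  intro h0
  exact hA.eigenvectorBasis.orthonormal.ne_zero i (by ext j; exact congrFun h0 j)

namespace SimpleGraph

theorem Connected.exists_adj_of_mem_of_notMem {V : Type*} {G : SimpleGraph V} (hG : G.Connected)
    {S : Set V} {u v : V} (hu : u ∈ S) (hv : v ∉ S) : ∃ x ∈ S, ∃ y ∉ S, G.Adj x y := by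
  obtain ⟨p⟩ := hG.preconnected u v
  obtain ⟨d, -, h1, h2⟩ := p.exists_boundary_dart S hu hv
  exact ⟨d.fst, h1, d.snd, h2, d.adj⟩

section Perron

variable {V : Type*} [Fintype V] {G : SimpleGraph V} [DecidableRel G.Adj] {θ : ℝ}

open Matrix

theorem Connected.pos_of_adjMatrix_mulVec_eq (hG : G.Connected) {f : V → ℝ} (hf : ∀ x, 0 ≤ f x)
    (hf0 : f ≠ 0) (he : G.adjMatrix ℝ *ᵥ f = θ • f) (x : V) : 0 < f x := by
  by_contra hx
  have hx0 : f x = 0 := le_antisymm (not_lt.1 hx) (hf x)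
  obtain ⟨v, hv⟩ := Function.ne_iff.1 hf0
  obtain ⟨a, ha, b, hb, hab⟩ :=
    hG.exists_adj_of_mem_of_notMem (S := {z | f z = 0}) (u := x) (v := v) hx0 hv
  have h1 := congrFun he a
  rw [adjMatrix_mulVec_apply, Pi.smul_apply, show f a = 0 from ha, smul_zero] at h1
  exact hb ((Finset.sum_eq_zero_iff_of_nonneg fun z _ => hf z).1 h1 b (by simpa using hab))

variable [DecidableEq V]

theorem adjMatrix_mulVec_abs_eq (hpsd : (θ • (1 : Matrix V V ℝ) - G.adjMatrix ℝ).PosSemidef)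
    {f : V → ℝ} (he : G.adjMatrix ℝ *ᵥ f = θ • f) :
    G.adjMatrix ℝ *ᵥ (fun x => |f x|) = θ • fun x => |f x| := by
  set K := θ • (1 : Matrix V V ℝ) - G.adjMatrix ℝ with hK
  have hKv : ∀ g : V → ℝ, K *ᵥ g = θ • g - G.adjMatrix ℝ *ᵥ g := by
    intro g
    rw [hK, Matrix.sub_mulVec, Matrix.smul_mulVec, Matrix.one_mulVec]
  have h0 : f ⬝ᵥ (K *ᵥ f) = 0 := by rw [hKv, he]; simp
  have hle : (fun x => |f x|) ⬝ᵥ (K *ᵥ fun x => |f x|) ≤ f ⬝ᵥ (K *ᵥ f) := by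
    rw [hKv, hKv]
    simp only [dotProduct, Pi.sub_apply, Pi.smul_apply, smul_eq_mul, adjMatrix_mulVec_apply]
    refine Finset.sum_le_sum fun x _ => ?_
    have h1 : f x * ∑ u ∈ G.neighborFinset x, f u ≤ |f x| * ∑ u ∈ G.neighborFinset x, |f u| :=
      calc f x * ∑ u ∈ G.neighborFinset x, f u ≤ |f x * ∑ u ∈ G.neighborFinset x, f u| :=
            le_abs_self _
        _ = |f x| * |∑ u ∈ G.neighborFinset x, f u| := abs_mul _ _
        _ ≤ _ := mul_le_mul_of_nonneg_left (Finset.abs_sum_le_sum_abs _ _) (abs_nonneg _)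
    have h2 := abs_mul_abs_self (f x)
    linear_combination h1 + θ * h2
  have hz : (fun x => |f x|) ⬝ᵥ (K *ᵥ fun x => |f x|) = 0 :=
    le_antisymm (hle.trans h0.le) (by simpa using hpsd.dotProduct_mulVec_nonneg fun x => |f x|)
  have := (hpsd.dotProduct_mulVec_zero_iff fun x => |f x|).1 (by simpa using hz)
  rw [hKv, sub_eq_zero] at this
  exact this.symm

theorem Connected.exists_pos_eigenvector (hG : G.Connected)
    (hpsd : (θ • (1 : Matrix V V ℝ) - G.adjMatrix ℝ).PosSemidef)
    (hex : ∃ f : V → ℝ, f ≠ 0 ∧ G.adjMatrix ℝ *ᵥ f = θ • f) :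
    ∃ α : V → ℝ, (∀ x, 0 < α x) ∧ G.adjMatrix ℝ *ᵥ α = θ • α ∧
      ∀ f : V → ℝ, G.adjMatrix ℝ *ᵥ f = θ • f → ∃ c : ℝ, f = c • α := by
  obtain ⟨f, hf0, hf⟩ := hex
  have hpos : ∀ g : V → ℝ, g ≠ 0 → G.adjMatrix ℝ *ᵥ g = θ • g → ∀ x, 0 < |g x| := by
    intro g hg0 hg
    refine hG.pos_of_adjMatrix_mulVec_eq (fun x => abs_nonneg _) ?_ (adjMatrix_mulVec_abs_eq hpsd hg)
    contrapose! hg0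
    ext x
    simpa using congrFun hg0 x
  refine ⟨_, hpos f hf0 hf, adjMatrix_mulVec_abs_eq hpsd hf, fun g hg => ?_⟩
  obtain ⟨v⟩ := hG.nonempty
  have hv := (hpos f hf0 hf v).ne'
  refine ⟨g v / |f v|, ?_⟩
  by_contra hne
  have := hpos (g - (g v / |f v|) • fun x => |f x|) (sub_ne_zero.2 hne) (by
    rw [Matrix.mulVec_sub, Matrix.mulVec_smul, hg, adjMatrix_mulVec_abs_eq hpsd hf, smul_sub,
      smul_comm]) v
  simp [hv] at this

end Perron

end SimpleGraph

open Matrix in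
theorem InG3.exists_pos_rank_one {V : Type} [Fintype V] [DecidableEq V] {G : SimpleGraph V}
    [DecidableRel G.Adj] {θ0 θ1 θ2 : ℝ} (h : InG3 G θ0 θ1 θ2) :
    ∃ α : V → ℝ, (∀ x, 0 < α x) ∧ ∀ x y,
      (G.adjMatrix ℝ * G.adjMatrix ℝ) x y - (θ1 + θ2) * G.adjMatrix ℝ x y +
        θ1 * θ2 * (1 : Matrix V V ℝ) x y = α x * α y := by
  obtain ⟨hG, h01, h12, hset⟩ := h
  have hA : (G.adjMatrix ℝ).IsHermitian := G.isHermitian_adjMatrix ℝ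
  have hmem : ∀ (f : V → ℝ) (θ : ℝ), f ≠ 0 → G.adjMatrix ℝ *ᵥ f = θ • f →
      θ = θ0 ∨ θ = θ1 ∨ θ = θ2 := by
    intro f θ hf he
    simpa using hset.subset (show θ ∈ {θ | adjEig G θ} from ⟨f, hf, he⟩)
  have hex : adjEig G θ0 := hset.symm.subset (by simp : θ0 ∈ ({θ0, θ1, θ2} : Set ℝ))
  have hpsd : (θ0 • (1 : Matrix V V ℝ) - G.adjMatrix ℝ).PosSemidef := by
    refine Matrix.IsHermitian.posSemidef_of_eigenvector
      ((Matrix.isHermitian_one.smul (IsSelfAdjoint.all θ0)).sub hA) fun f θ hf he => ?_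
    rw [Matrix.sub_mulVec, Matrix.smul_mulVec, Matrix.one_mulVec] at he
    have := hmem f (θ0 - θ) hf (by rw [sub_smul, ← he]; abel)
    rcases this with h | h | h <;> linarith
  obtain ⟨α, hα, hαe, hspan⟩ := hG.exists_pos_eigenvector hpsd hex
  set M := (G.adjMatrix ℝ - θ1 • (1 : Matrix V V ℝ)) * (G.adjMatrix ℝ - θ2 • (1 : Matrix V V ℝ))
    with hM
  have hexp : M = G.adjMatrix ℝ * G.adjMatrix ℝ - (θ1 + θ2) • G.adjMatrix ℝ + (θ1 * θ2) • 1 := by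
    rw [hM, Matrix.sub_mul, Matrix.mul_sub, Matrix.mul_sub]
    simp only [Matrix.smul_mul, Matrix.mul_smul, Matrix.one_mul, Matrix.mul_one, smul_smul]
    module
  have hcub := hA.cubic_eq_zero hmem
  rw [← hM, Matrix.sub_mul, Matrix.smul_mul, Matrix.one_mul, sub_eq_zero] at hcub
  have hcol : ∀ y, ∃ c : ℝ, ∀ x, M x y = c * α x := by
    intro y
    obtain ⟨c, hc⟩ := hspan (fun x => M x y) (by
      ext x
      simpa [Matrix.mul_apply, Matrix.mulVec, dotProduct] using congrFun (congrFun hcub x) y)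
    exact ⟨c, fun x => congrFun hc x⟩
  choose c hc using hcol
  have hsymm : ∀ x y, M x y = M y x := by
    intro x y
    have : Mᵀ = M := by
      rw [hexp]
      simp [Matrix.transpose_mul]
    conv_lhs => rw [← this]
    rfl
  obtain ⟨v⟩ := hG.nonempty
  have hv := hα v
  set t := c v / α v with ht
  have hct : ∀ y, c y = t * α y := by
    intro y
    have := hsymm v y
    rw [hc, hc] at this
    rw [ht]
    field_simp
    linarith
  have hMα : M *ᵥ α = ((θ0 - θ1) * (θ0 - θ2)) • α := by
    rw [hM, ← Matrix.mulVec_mulVec]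
    simp only [Matrix.sub_mulVec, Matrix.smul_mulVec, Matrix.one_mulVec, hαe, Matrix.mulVec_smul,
      Matrix.mulVec_sub]
    module
  have hsum : t * ∑ y, α y * α y = (θ0 - θ1) * (θ0 - θ2) := by
    have := congrFun hMα v
    simp only [Matrix.mulVec, dotProduct, hc, hct, Pi.smul_apply, smul_eq_mul] at this
    rw [Finset.mul_sum]
    apply mul_right_cancel₀ hv.ne'
    rw [← this, Finset.sum_mul]
    exact Finset.sum_congr rfl fun y _ => by ring
  have htpos : 0 < t := by
    refine pos_of_mul_pos_left (b := ∑ y, α y * α y) ?_ 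
      (Finset.sum_nonneg fun y _ => mul_self_nonneg _)
    rw [hsum]
    exact mul_pos (by linarith) (by linarith)
  refine ⟨fun x => √t * α x, fun x => mul_pos (Real.sqrt_pos.2 htpos) (hα x), fun x y => ?_⟩
  have h1 : M x y = t * α x * α y := by rw [hc, hct]; ring
  rw [hexp] at h1
  simp only [Matrix.add_apply, Matrix.sub_apply, Matrix.smul_apply, smul_eq_mul] at h1
  rw [h1]
  have := Real.mul_self_sqrt htpos.le
  linear_combination (-(α x * α y)) * this

theorem SimpleGraph.adjMatrix_mul_self_apply {V : Type*} [Fintype V] [DecidableEq V]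
    (G : SimpleGraph V) [DecidableRel G.Adj] (x y : V) :
    (G.adjMatrix ℝ * G.adjMatrix ℝ) x y = ((G.neighborFinset x ∩ G.neighborFinset y).card : ℝ) := by
  rw [SimpleGraph.adjMatrix_mul_apply]
  simp only [SimpleGraph.adjMatrix_apply, Finset.sum_boole]
  congr 2
  ext z
  simp [G.adj_comm z y]

/-- The form in which the three-eigenvalue hypothesis is used: vertex degrees and numbers of common
neighbours are controlled by a positive weight function. -/
theorem InG3.exists_weight {V : Type} [Fintype V] [DecidableEq V] {G : SimpleGraph V}
    [DecidableRel G.Adj] {θ0 θ1 θ2 : ℝ} (h : InG3 G θ0 θ1 θ2) :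
    ∃ α : V → ℝ, (∀ x, 0 < α x) ∧ (∀ x, (G.degree x : ℝ) = α x ^ 2 - θ1 * θ2) ∧
      (∀ x y, G.Adj x y →
        ((G.neighborFinset x ∩ G.neighborFinset y).card : ℝ) = α x * α y + (θ1 + θ2)) ∧
      (∀ x y, x ≠ y → ¬ G.Adj x y →
        ((G.neighborFinset x ∩ G.neighborFinset y).card : ℝ) = α x * α y) := by
  obtain ⟨α, hα, hM⟩ := h.exists_pos_rank_one
  refine ⟨α, hα, fun x => ?_, fun x y hxy => ?_, fun x y hne hxy => ?_⟩
  · have := hM x x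
    rw [SimpleGraph.adjMatrix_mul_self_apply_self] at this
    simp at this
    linarith
  · have := hM x y
    rw [SimpleGraph.adjMatrix_mul_self_apply, Matrix.one_apply_ne hxy.ne] at this
    simp [hxy] at this
    linarith
  · have := hM x y
    rw [SimpleGraph.adjMatrix_mul_self_apply, Matrix.one_apply_ne hne] at this
    simp [hxy] at this
    linarith

open Matrix in
theorem adjEig_neg_one_of_twins {V : Type} [Fintype V] [DecidableEq V] {G : SimpleGraph V}
    [DecidableRel G.Adj] {x y : V} (hxy : G.Adj x y)
    (htwin : ∀ z, z ≠ x → z ≠ y → (G.Adj z x ↔ G.Adj z y)) : adjEig G (-1) := by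
  refine ⟨Pi.single x 1 - Pi.single y 1, fun h0 => ?_, ?_⟩
  · simpa [hxy.ne] using congrFun h0 x
  · ext z
    rw [Matrix.mulVec_sub, Matrix.mulVec_single_one, Matrix.mulVec_single_one]
    by_cases hx : z = x
    · subst hx
      simp [hxy, hxy.ne]
    · by_cases hy : z = y
      · subst hy
        simp [hxy.symm, hx]
      · simp [hx, hy, htwin z hx hy]

open Matrix in
/-- A graph with an induced path on three vertices has smallest eigenvalue below `-1`. -/
theorem InG3.ne_neg_one_of_induced_path {V : Type} [Fintype V] [DecidableEq V] {G : SimpleGraph V}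
    [DecidableRel G.Adj] {θ0 θ1 θ2 : ℝ} (h : InG3 G θ0 θ1 θ2) {u c w : V} (huc : G.Adj u c)
    (hcw : G.Adj c w) (huw : ¬ G.Adj u w) (hne : u ≠ w) : θ2 ≠ -1 := by
  rintro rfl
  obtain ⟨-, h01, h12, hset⟩ := h
  have hpsd : (G.adjMatrix ℝ + 1).PosSemidef := by
    refine Matrix.IsHermitian.posSemidef_of_eigenvector
      ((G.isHermitian_adjMatrix ℝ).add Matrix.isHermitian_one) fun f θ hf he => ?_
    rw [Matrix.add_mulVec, Matrix.one_mulVec] at he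
    have : θ - 1 ∈ ({θ0, θ1, -1} : Set ℝ) :=
      hset.subset ⟨f, hf, by rw [sub_smul, ← he, one_smul, add_sub_cancel_right]⟩
    rcases this with h | h | h
    · linarith
    · linarith
    · linarith [Set.mem_singleton_iff.1 h]
  have hq := hpsd.dotProduct_mulVec_nonneg (Pi.single u 1 - Pi.single c 1 + Pi.single w 1)
  simp only [star_trivial, add_dotProduct, sub_dotProduct, Matrix.mulVec_add,
    Matrix.mulVec_sub, Matrix.mulVec_single_one, single_one_dotProduct, Pi.add_apply, Pi.sub_apply,
    Matrix.col_apply, Matrix.add_apply, SimpleGraph.adjMatrix_apply, Matrix.one_apply] at hq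
  simp [huc, huc.symm, hcw, hcw.symm, huw, G.adj_comm w u, huc.ne, huc.ne', hcw.ne, hcw.ne', hne,
    hne.symm] at hq
  linarith

/-- The parts `U - C - W` cannot be joined in a path if the degrees in the end part `W` are
smaller than a degree in the end part `U`. -/
theorem InG3.false_of_path {V : Type} [Fintype V] [DecidableEq V] {G : SimpleGraph V}
    [DecidableRel G.Adj] {θ0 θ1 θ2 : ℝ} (h : InG3 G θ0 θ1 θ2) {U C W : Finset V}
    (hcover : ∀ v, v ∈ U ∨ v ∈ C ∨ v ∈ W) (hUC : ∀ x ∈ U, ∀ y ∈ C, G.Adj x y)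
    (hCW : ∀ x ∈ C, ∀ y ∈ W, G.Adj x y) (hUW : ∀ x ∈ U, ∀ y ∈ W, ¬ G.Adj x y)
    {u c : V} (hu : u ∈ U) (hc : c ∈ C) (hW : 2 ≤ W.card)
    (hlt : ∀ w ∈ W, G.degree w < G.degree u) : False := by
  obtain ⟨α, hα, hdeg, -, hnadj⟩ := h.exists_weight
  have hne : ∀ w ∈ W, u ≠ w := by
    rintro w hw rfl
    exact lt_irrefl _ (hlt _ hw)
  have hαlt : ∀ w ∈ W, α w < α u := by
    intro w hw
    have h1 : (G.degree w : ℝ) < G.degree u := by exact_mod_cast hlt w hw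
    rw [hdeg, hdeg] at h1
    exact lt_of_pow_lt_pow_left₀ 2 (hα u).le (by linarith)
  have hcard : ∀ w ∈ W, α u * α w ≤ C.card := by
    intro w hw
    rw [← hnadj u w (hne w hw) (hUW u hu w hw)]
    refine Nat.cast_le.2 (Finset.card_le_card fun v hv => ?_)
    simp only [Finset.mem_inter, SimpleGraph.mem_neighborFinset] at hv
    rcases hcover v with hv' | hv' | hv'
    · exact absurd hv.2.symm (hUW v hv' w hw)
    · exact hv'
    · exact absurd hv.1 (hUW u hu v hv')
  have hclique : ∀ x ∈ W, ∀ y ∈ W, x ≠ y → G.Adj x y := by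
    intro x hx y hy hxy
    by_contra hadj
    have h1 : (C.card : ℝ) ≤ α x * α y := by
      rw [← hnadj x y hxy hadj]
      refine Nat.cast_le.2 (Finset.card_le_card fun v hv => ?_)
      simpa using ⟨(hCW v hv x hx).symm, (hCW v hv y hy).symm⟩
    nlinarith [hcard x hx, hαlt y hy, hα x]
  obtain ⟨w, hw, w', hw', hww'⟩ := Finset.one_lt_card.1 hW
  have hp : θ1 * θ2 < 0 := by
    have h1 : (C.card : ℝ) ≤ G.degree w := by
      refine Nat.cast_le.2 (Finset.card_le_card fun v hv => ?_)
      simpa using (hCW v hv w hw).symm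
    rw [hdeg] at h1
    nlinarith [hcard w hw, hαlt w hw, hα w]
  have hneg : adjEig G (-1) := by
    refine adjEig_neg_one_of_twins (hclique w hw w' hw' hww') fun z hz hz' => ?_
    rcases hcover z with hzU | hzC | hzW
    · exact iff_of_false (hUW z hzU w hw) (hUW z hzU w' hw')
    · exact iff_of_true (hCW z hzC w hw) (hCW z hzC w' hw')
    · exact iff_of_true (hclique z hzW w hw hz) (hclique z hzW w' hw' hz')
  refine h.ne_neg_one_of_induced_path (hUC u hu c hc) (hCW c hc w hw) (hUW u hu w hw) (hne w hw) ?_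
  obtain ⟨-, h01, h12, hset⟩ := h
  have hmem : (-1 : ℝ) ∈ ({θ0, θ1, θ2} : Set ℝ) := hset.subset hneg
  rcases hmem with h | h | h
  · nlinarith
  · nlinarith
  · exact (Set.mem_singleton_iff.1 h).symm

/-- If any two of three pairwise adjacent vertices dominate the graph, the degree of the third
vertex occurs at one of the first two. -/
theorem InG3.false_of_triangle {V : Type} [Fintype V] [DecidableEq V] {G : SimpleGraph V}
    [DecidableRel G.Adj] {θ0 θ1 θ2 : ℝ} (h : InG3 G θ0 θ1 θ2) {x y z : V}
    (hxy : G.Adj x y) (hxz : G.Adj x z) (hyz : G.Adj y z)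
    (hcxy : ∀ v, G.Adj x v ∨ G.Adj y v) (hcxz : ∀ v, G.Adj x v ∨ G.Adj z v)
    (hcyz : ∀ v, G.Adj y v ∨ G.Adj z v)
    (hdxz : G.degree x ≠ G.degree z) (hdyz : G.degree y ≠ G.degree z) : False := by
  obtain ⟨α, hα, hdeg, hadj, -⟩ := h.exists_weight
  have key : ∀ a b, G.Adj a b → (∀ v, G.Adj a v ∨ G.Adj b v) →
      α a ^ 2 + α b ^ 2 - α a * α b = Fintype.card V + (θ1 + θ2) + 2 * (θ1 * θ2) := by
    intro a b hab hcov
    have h1 := Finset.card_union_add_card_inter (G.neighborFinset a) (G.neighborFinset b)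
    rw [show G.neighborFinset a ∪ G.neighborFinset b = Finset.univ by ext v; simpa using hcov v,
      Finset.card_univ, SimpleGraph.card_neighborFinset_eq_degree,
      SimpleGraph.card_neighborFinset_eq_degree] at h1
    have h2 : (Fintype.card V : ℝ) + ((G.neighborFinset a ∩ G.neighborFinset b).card : ℝ) =
      G.degree a + G.degree b := by exact_mod_cast h1
    rw [hadj a b hab, hdeg, hdeg] at h2
    linarith
  have hne : ∀ a b, G.degree a ≠ G.degree b → α a - α b ≠ 0 := by
    intro a b hab h0
    apply hab
    have : (G.degree a : ℝ) = G.degree b := by rw [hdeg, hdeg, sub_eq_zero.1 h0]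
    exact_mod_cast this
  have k1 := key x y hxy hcxy
  have k2 := key x z hxz hcxz
  have k3 := key y z hyz hcyz
  have e1 : α y + α z = α x :=
    mul_left_cancel₀ (hne y z hdyz) (by linear_combination k1 - k2)
  have e2 : α x + α z = α y :=
    mul_left_cancel₀ (hne x z hdxz) (by linear_combination k1 - k3)
  linarith [hα z]

theorem SimpleGraph.Connected.false_of_isolated_part {V : Type*} {G : SimpleGraph V}
    (hG : G.Connected) {U C W : Finset V} (hcover : ∀ v, v ∈ U ∨ v ∈ C ∨ v ∈ W)
    (hUC : ∀ x ∈ U, ∀ y ∈ C, ¬ G.Adj x y) (hUW : ∀ x ∈ U, ∀ y ∈ W, ¬ G.Adj x y)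
    {u c : V} (hu : u ∈ U) (hc : c ∉ U) : False := by
  obtain ⟨x, hx, y, hy, hxy⟩ :=
    hG.exists_adj_of_mem_of_notMem (S := {v | v ∈ U}) (u := u) (v := c) hu hc
  rcases hcover y with h | h | h
  · exact hy h
  · exact hUC x hx y h hxy
  · exact hUW x hx y h hxy

/-- Degrees are constant on a part that is regular and uniformly joined to the two others. -/
theorem SimpleGraph.degree_eq_of_mem_part {V : Type*} [Fintype V] [DecidableEq V]
    {G : SimpleGraph V} [DecidableRel G.Adj] {U C W : Finset V} (hUC' : Disjoint U C)
    (hUW' : Disjoint U W) (hCW' : Disjoint C W) (hcover : U ∪ C ∪ W = Finset.univ)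
    (hreg : ∃ e : ℕ, ∀ x ∈ U, (U.filter (fun y => G.Adj x y)).card = e)
    (hUC : (∀ x ∈ U, ∀ y ∈ C, G.Adj x y) ∨ (∀ x ∈ U, ∀ y ∈ C, ¬ G.Adj x y))
    (hUW : (∀ x ∈ U, ∀ y ∈ W, G.Adj x y) ∨ (∀ x ∈ U, ∀ y ∈ W, ¬ G.Adj x y))
    {x y : V} (hx : x ∈ U) (hy : y ∈ U) : G.degree x = G.degree y := by
  obtain ⟨e, he⟩ := hreg
  have hd : ∀ z, G.degree z = (U.filter (fun y => G.Adj z y)).card +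
      (C.filter (fun y => G.Adj z y)).card + (W.filter (fun y => G.Adj z y)).card := by
    intro z
    rw [← SimpleGraph.card_neighborFinset_eq_degree, SimpleGraph.neighborFinset_eq_filter,
      ← hcover, Finset.filter_union, Finset.filter_union, Finset.card_union_of_disjoint,
      Finset.card_union_of_disjoint (Finset.disjoint_filter_filter hUC')]
    rw [← Finset.filter_union]
    exact Finset.disjoint_filter_filter (Finset.disjoint_union_left.2 ⟨hUW', hCW'⟩)
  have hconst : ∀ D : Finset V, (∀ x ∈ U, ∀ y ∈ D, G.Adj x y) ∨ (∀ x ∈ U, ∀ y ∈ D, ¬ G.Adj x y) →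
      D.filter (fun z => G.Adj x z) = D.filter (fun z => G.Adj y z) := by
    rintro D (h | h) <;> refine Finset.filter_congr fun z hz => ?_
    · exact iff_of_true (h x hx z hz) (h y hy z hz)
    · exact iff_of_false (h x hx z hz) (h y hy z hz)
  rw [hd, hd, he x hx, he y hy, hconst C hUC, hconst W hUW]

/-- No triregular graph in `𝒢₃` admits a partition `V1, V2, V3` into parts of size at
least `2` such that each induced subgraph is regular and each bipartite graph between two
distinct parts is complete or empty. -/
theorem stmt15 {V : Type} [Fintype V] [DecidableEq V] (G : SimpleGraph V) [DecidableRel G.Adj]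
    (θ0 θ1 θ2 : ℝ) (h : InG3 G θ0 θ1 θ2)
    (d1 d2 d3 : ℕ) (hd12 : d1 ≠ d2) (hd13 : d1 ≠ d3) (hd23 : d2 ≠ d3)
    (hdeg : ∀ x : V, G.degree x = d1 ∨ G.degree x = d2 ∨ G.degree x = d3)
    (he1 : ∃ x : V, G.degree x = d1) (he2 : ∃ x : V, G.degree x = d2)
    (he3 : ∃ x : V, G.degree x = d3)
    (V1 V2 V3 : Finset V)
    (hc1 : 2 ≤ V1.card) (hc2 : 2 ≤ V2.card) (hc3 : 2 ≤ V3.card)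
    (h12 : Disjoint V1 V2) (h13 : Disjoint V1 V3) (h23 : Disjoint V2 V3)
    (hcover : V1 ∪ V2 ∪ V3 = Finset.univ)
    (hreg1 : ∃ e : ℕ, ∀ x ∈ V1, (V1.filter (fun y => G.Adj x y)).card = e)
    (hreg2 : ∃ e : ℕ, ∀ x ∈ V2, (V2.filter (fun y => G.Adj x y)).card = e)
    (hreg3 : ∃ e : ℕ, ∀ x ∈ V3, (V3.filter (fun y => G.Adj x y)).card = e)
    (hV12 : (∀ x ∈ V1, ∀ y ∈ V2, G.Adj x y) ∨ (∀ x ∈ V1, ∀ y ∈ V2, ¬ G.Adj x y))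
    (hV13 : (∀ x ∈ V1, ∀ y ∈ V3, G.Adj x y) ∨ (∀ x ∈ V1, ∀ y ∈ V3, ¬ G.Adj x y))
    (hV23 : (∀ x ∈ V2, ∀ y ∈ V3, G.Adj x y) ∨ (∀ x ∈ V2, ∀ y ∈ V3, ¬ G.Adj x y)) :
    False := by
  have hcov : ∀ v, v ∈ V1 ∨ v ∈ V2 ∨ v ∈ V3 := by
    intro v
    simpa [or_assoc] using hcover.symm.subset (Finset.mem_univ v)
  have swap : ∀ {S T : Finset V},
      (∀ x ∈ S, ∀ y ∈ T, G.Adj x y) ∨ (∀ x ∈ S, ∀ y ∈ T, ¬ G.Adj x y) →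
      (∀ x ∈ T, ∀ y ∈ S, G.Adj x y) ∨ (∀ x ∈ T, ∀ y ∈ S, ¬ G.Adj x y) := by
    rintro S T (h | h)
    · exact Or.inl fun x hx y hy => (h y hy x hx).symm
    · exact Or.inr fun x hx y hy hxy => h y hy x hx hxy.symm
  obtain ⟨x1, hx1⟩ := Finset.card_pos.1 (by omega : 0 < V1.card)
  obtain ⟨x2, hx2⟩ := Finset.card_pos.1 (by omega : 0 < V2.card)
  obtain ⟨x3, hx3⟩ := Finset.card_pos.1 (by omega : 0 < V3.card)
  have r1 : ∀ x ∈ V1, G.degree x = G.degree x1 := fun x hx =>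
    SimpleGraph.degree_eq_of_mem_part h12 h13 h23 hcover hreg1 hV12 hV13 hx hx1
  have r2 : ∀ x ∈ V2, G.degree x = G.degree x2 := fun x hx =>
    SimpleGraph.degree_eq_of_mem_part h12.symm h23 h13 (by rw [← hcover, Finset.union_comm V2])
      hreg2 (swap hV12) hV23 hx hx2
  have r3 : ∀ x ∈ V3, G.degree x = G.degree x3 := fun x hx =>
    SimpleGraph.degree_eq_of_mem_part h13.symm h23.symm h12
      (by rw [← hcover, Finset.union_assoc, Finset.union_comm V3]) hreg3 (swap hV13) (swap hV23)
      hx hx3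
  have hval : ∀ x, G.degree x = G.degree x1 ∨ G.degree x = G.degree x2 ∨
      G.degree x = G.degree x3 := fun x =>
    (hcov x).imp (r1 x) (Or.imp (r2 x) (r3 x))
  obtain ⟨y1, rfl⟩ := he1
  obtain ⟨y2, rfl⟩ := he2
  obtain ⟨y3, rfl⟩ := he3
  have n12 : G.degree x1 ≠ G.degree x2 := by
    clear * - hval hd12 hd13 hd23; grind
  have n13 : G.degree x1 ≠ G.degree x3 := by
    clear * - hval hd12 hd13 hd23; grind
  have n23 : G.degree x2 ≠ G.degree x3 := by
    clear * - hval hd12 hd13 hd23; grind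
  have path : ∀ {U C W : Finset V} {u c w : V}, (∀ v, v ∈ U ∨ v ∈ C ∨ v ∈ W) →
      (∀ x ∈ U, ∀ y ∈ C, G.Adj x y) → (∀ x ∈ C, ∀ y ∈ W, G.Adj x y) →
      (∀ x ∈ U, ∀ y ∈ W, ¬ G.Adj x y) → u ∈ U → c ∈ C → w ∈ W → 2 ≤ U.card → 2 ≤ W.card →
      (∀ x ∈ U, G.degree x = G.degree u) → (∀ x ∈ W, G.degree x = G.degree w) →
      G.degree u ≠ G.degree w → False := by
    intro U C W u c w hcov hUC hCW hUW hu hc hw hU hW ru rw' hne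
    rcases lt_or_gt_of_ne hne with hlt | hlt
    · exact h.false_of_path (U := W) (C := C) (W := U)
        (fun v => by rcases hcov v with hv | hv | hv <;> simp [hv])
        (fun x hx y hy => (hCW y hy x hx).symm) (fun x hx y hy => (hUC y hy x hx).symm)
        (fun x hx y hy hxy => hUW y hy x hx hxy.symm) hw hc hU (fun x hx => by rwa [ru x hx])
    · exact h.false_of_path hcov hUC hCW hUW hu hc hW (fun x hx => by rwa [rw' x hx])
  have hcov2 : ∀ v, v ∈ V2 ∨ v ∈ V1 ∨ v ∈ V3 := fun v => by
    rcases hcov v with hv | hv | hv <;> simp [hv]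
  have hcov3 : ∀ v, v ∈ V3 ∨ v ∈ V1 ∨ v ∈ V2 := fun v => by
    rcases hcov v with hv | hv | hv <;> simp [hv]
  have a21 := fun h : (∀ x ∈ V1, ∀ y ∈ V2, G.Adj x y) => fun x hx y hy => (h y hy x hx).symm
  have a32 := fun h : (∀ x ∈ V2, ∀ y ∈ V3, G.Adj x y) => fun x hx y hy => (h y hy x hx).symm
  have b21 := fun (h : ∀ x ∈ V1, ∀ y ∈ V2, ¬ G.Adj x y) x hx y hy (e : G.Adj x y) =>
    h y hy x hx e.symm
  have b31 := fun (h : ∀ x ∈ V1, ∀ y ∈ V3, ¬ G.Adj x y) x hx y hy (e : G.Adj x y) =>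
    h y hy x hx e.symm
  have b32 := fun (h : ∀ x ∈ V2, ∀ y ∈ V3, ¬ G.Adj x y) x hx y hy (e : G.Adj x y) =>
    h y hy x hx e.symm
  rcases hV12 with c12 | c12 <;> rcases hV13 with c13 | c13 <;> rcases hV23 with c23 | c23
  · refine h.false_of_triangle (c12 x1 hx1 x2 hx2) (c13 x1 hx1 x3 hx3) (c23 x2 hx2 x3 hx3)
      (fun v => ?_) (fun v => ?_) (fun v => ?_) n13 n23
    · rcases hcov v with hv | hv | hv
      · exact Or.inr (c12 v hv x2 hx2).symm
      · exact Or.inl (c12 x1 hx1 v hv)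
      · exact Or.inl (c13 x1 hx1 v hv)
    · rcases hcov v with hv | hv | hv
      · exact Or.inr (c13 v hv x3 hx3).symm
      · exact Or.inl (c12 x1 hx1 v hv)
      · exact Or.inl (c13 x1 hx1 v hv)
    · rcases hcov v with hv | hv | hv
      · exact Or.inl (c12 v hv x2 hx2).symm
      · exact Or.inr (c23 v hv x3 hx3).symm
      · exact Or.inl (c23 x2 hx2 v hv)
  · exact path hcov2 (a21 c12) c13 c23 hx2 hx1 hx3 hc2 hc3 r2 r3 n23
  · exact path hcov c12 c23 c13 hx1 hx2 hx3 hc1 hc3 r1 r3 n13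
  · exact h.1.false_of_isolated_part hcov3 (b31 c13) (b32 c23) hx3 (Finset.disjoint_left.1 h13 hx1)
  · exact path (fun v => by rcases hcov v with hv | hv | hv <;> simp [hv]) c13
      (a32 c23) c12 hx1 hx3 hx2 hc1 hc2 r1 r2 n12
  · exact h.1.false_of_isolated_part hcov2 (b21 c12) c23 hx2 (Finset.disjoint_left.1 h12 hx1)
  · exact h.1.false_of_isolated_part hcov c12 c13 hx1 (Finset.disjoint_right.1 h12 hx2)
  · exact h.1.false_of_isolated_part hcov c12 c13 hx1 (Finset.disjoint_right.1 h12 hx2)
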